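/- (Theorem 2, selection consistency) Under conditions (C1) and (C2), if a_w/√N → 0 in probability and b_w/√N → ∞ in probability, then the regularized maximum likelihood estimator θ̂_N = argmin_{θ∈Θ} { −L_N(θ) + λ_N Σ_{k=1}^p w_k |θ_k| } sets all truly zero coefficients to zero with probability tending to one: P( θ̂_{N,k} = 0 for all k ∉ A ) → 1 as n → ∞. -/

import Mathlib

open Finset Real
open scoped Classical

noncomputable section

variable {E : Type*}

/-- Numeric 0/1 value of a Boolean edge indicator. -/
def bval (b : Bool) : ℝ := if b then 1 else 0

/-- Ordered pairs `(j1, j2)` of nodes with `j1 < j2` (the dyads). -/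
def pairsLT (n : ℕ) : Finset (Fin n × Fin n) := univ.filter fun q => q.1 < q.2

/-- Ordered pairs `(j1, j2)` of nodes with `j1 ≠ j2` (the potential directed edges). -/
def pairsNE (n : ℕ) : Finset (Fin n × Fin n) := univ.filter fun q => q.1 ≠ q.2

/-- The finite set of zero-diagonal binary adjacency matrices on `n` nodes. -/
def nets (n : ℕ) : Finset (Fin n → Fin n → Bool) :=
  univ.filter fun x => ∀ j, x j j = false

/-- The exponent `H_θ(x)` of the directed network model with nodal homophily and
nodal effects, with parameter `θ = (θ1, θ2, γ, ζ, η)`. -/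
def Hexp (n m : ℕ) (v : Fin n → Fin m → E) (w : E → E → ℝ) (g : E → ℝ)
    (θ1 θ2 : ℝ) (γ ζ η : Fin m → ℝ) (x : Fin n → Fin n → Bool) : ℝ :=
  θ1 * ∑ q ∈ pairsLT n, bval (x q.1 q.2) * bval (x q.2 q.1)
    + θ2 * ∑ q ∈ pairsNE n, bval (x q.1 q.2)
    + ∑ k, γ k * ∑ q ∈ pairsNE n, bval (x q.1 q.2) * w (v q.1 k) (v q.2 k)
    + ∑ k, ζ k * ∑ q ∈ pairsNE n, bval (x q.1 q.2) * g (v q.1 k)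
    + ∑ k, η k * ∑ q ∈ pairsNE n, bval (x q.1 q.2) * g (v q.2 k)

/-- The dyad weight `T_{ab}(j1, j2)`; note `T_{00}(j1,j2) = 1`. -/
def Tdyad (n m : ℕ) (v : Fin n → Fin m → E) (w : E → E → ℝ) (g : E → ℝ)
    (θ1 θ2 : ℝ) (γ ζ η : Fin m → ℝ) (j1 j2 : Fin n) (a b : Bool) : ℝ :=
  Real.exp (θ1 * (bval a * bval b)
    + (bval a + bval b) * (θ2 + ∑ k, γ k * w (v j1 k) (v j2 k))
    + ∑ k, ζ k * (bval a * g (v j1 k) + bval b * g (v j2 k))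
    + ∑ k, η k * (bval a * g (v j2 k) + bval b * g (v j1 k)))

/-- The normalizing constant `z(θ)` of the directed network model. -/
def zconst (n m : ℕ) (v : Fin n → Fin m → E) (w : E → E → ℝ) (g : E → ℝ)
    (θ1 θ2 : ℝ) (γ ζ η : Fin m → ℝ) : ℝ :=
  ∑ x ∈ nets n, Real.exp (Hexp n m v w g θ1 θ2 γ ζ η x)

/-- The probability mass function `P_θ(X = x) = exp H_θ(x) / z(θ)`. -/
def Pnet (n m : ℕ) (v : Fin n → Fin m → E) (w : E → E → ℝ) (g : E → ℝ)
    (θ1 θ2 : ℝ) (γ ζ η : Fin m → ℝ) (x : Fin n → Fin n → Bool) : ℝ :=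
  Real.exp (Hexp n m v w g θ1 θ2 γ ζ η x) / zconst n m v w g θ1 θ2 γ ζ η

/-- The marginal probability `P_θ(X_{j1j2} = a, X_{j2j1} = b)` of a dyad. -/
def Pdyad (n m : ℕ) (v : Fin n → Fin m → E) (w : E → E → ℝ) (g : E → ℝ)
    (θ1 θ2 : ℝ) (γ ζ η : Fin m → ℝ) (j1 j2 : Fin n) (a b : Bool) : ℝ :=
  ∑ x ∈ (nets n).filter (fun x => x j1 j2 = a ∧ x j2 j1 = b),
    Pnet n m v w g θ1 θ2 γ ζ η x

/-- The marginal probability `P_θ(X_{j1j2} = a)` of a single directed edge indicator. -/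
def Pedge (n m : ℕ) (v : Fin n → Fin m → E) (w : E → E → ℝ) (g : E → ℝ)
    (θ1 θ2 : ℝ) (γ ζ η : Fin m → ℝ) (j1 j2 : Fin n) (a : Bool) : ℝ :=
  ∑ x ∈ (nets n).filter (fun x => x j1 j2 = a), Pnet n m v w g θ1 θ2 γ ζ η x

/-- Index type for the parameter space `ℝ^p` with `p = 3m + 2`: two global parameters
`(θ1, θ2)`, the homophily block, the out-edge block and the in-edge block. -/
abbrev Idx (m : ℕ) := Fin 2 ⊕ (Fin m ⊕ (Fin m ⊕ Fin m))

/-- The vector of sufficient statistics `s(x) ∈ ℝ^p`: the coefficient of each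
coordinate of `θ` in `H_θ(x)`. -/
def svec (n m : ℕ) (v : Fin n → Fin m → E) (w : E → E → ℝ) (g : E → ℝ)
    (x : Fin n → Fin n → Bool) : Idx m → ℝ
  | Sum.inl i =>
      if i = 0 then ∑ q ∈ pairsLT n, bval (x q.1 q.2) * bval (x q.2 q.1)
      else ∑ q ∈ pairsNE n, bval (x q.1 q.2)
  | Sum.inr (Sum.inl k) => ∑ q ∈ pairsNE n, bval (x q.1 q.2) * w (v q.1 k) (v q.2 k)
  | Sum.inr (Sum.inr (Sum.inl k)) => ∑ q ∈ pairsNE n, bval (x q.1 q.2) * g (v q.1 k)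
  | Sum.inr (Sum.inr (Sum.inr k)) => ∑ q ∈ pairsNE n, bval (x q.1 q.2) * g (v q.2 k)

/-- The exponent of the model written as `H_θ(x) = θᵀ s(x)`. -/
def Hvec (n m : ℕ) (v : Fin n → Fin m → E) (w : E → E → ℝ) (g : E → ℝ)
    (θ : Idx m → ℝ) (x : Fin n → Fin n → Bool) : ℝ :=
  ∑ i, θ i * svec n m v w g x i

/-- The normalizing constant (partition function) `z(θ)`. -/
def Zvec (n m : ℕ) (v : Fin n → Fin m → E) (w : E → E → ℝ) (g : E → ℝ)
    (θ : Idx m → ℝ) : ℝ :=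
  ∑ x ∈ nets n, Real.exp (Hvec n m v w g θ x)

/-- The probability mass function `P_θ(X = x) = exp H_θ(x)/z(θ)`. -/
def Pvec (n m : ℕ) (v : Fin n → Fin m → E) (w : E → E → ℝ) (g : E → ℝ)
    (θ : Idx m → ℝ) (x : Fin n → Fin n → Bool) : ℝ :=
  Real.exp (Hvec n m v w g θ x) / Zvec n m v w g θ

/-- Expectation of a real statistic under `P_θ`. -/
def Emean (n m : ℕ) (v : Fin n → Fin m → E) (w : E → E → ℝ) (g : E → ℝ)
    (θ : Idx m → ℝ) (f : (Fin n → Fin n → Bool) → ℝ) : ℝ :=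
  ∑ x ∈ nets n, f x * Pvec n m v w g θ x

/-- The number of dyads `N = n(n−1)/2`. -/
def Ndyads (n : ℕ) : ℕ := n * (n - 1) / 2

/-- The Euclidean norm on `ℝ^p`. -/
def enorm {m : ℕ} (u : Idx m → ℝ) : ℝ := Real.sqrt (∑ i, u i ^ 2)

/-- The log-likelihood `L_N(θ) = H_θ(x) − log z(θ)` at the observed network `x`. -/
def Llik (n m : ℕ) (v : Fin n → Fin m → E) (w : E → E → ℝ) (g : E → ℝ)
    (θ : Idx m → ℝ) (x : Fin n → Fin n → Bool) : ℝ :=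
  Hvec n m v w g θ x - Real.log (Zvec n m v w g θ)

/-- Probability, under `P_{θ0}`, of the event `φ` (a set of zero-diagonal networks). -/
def Pr (n m : ℕ) (v : Fin n → Fin m → E) (w : E → E → ℝ) (g : E → ℝ)
    (θ0 : Idx m → ℝ) (φ : (Fin n → Fin n → Bool) → Prop) : ℝ :=
  ∑ x ∈ (nets n).filter (fun x => φ x), Pvec n m v w g θ0 x

/-- The Fisher information matrix `I_N(θ0) = Cov_{θ0}(∇_θ L_N(θ0))`.  Since the score
is `∇_θ L_N(θ0) = s(X) − E_{θ0}[s(X)]`, this is the covariance matrix of the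
sufficient statistic `s(X)` under `P_{θ0}`. -/
def Ifish (n m : ℕ) (v : Fin n → Fin m → E) (w : E → E → ℝ) (g : E → ℝ)
    (θ0 : Idx m → ℝ) : Matrix (Idx m) (Idx m) ℝ :=
  Matrix.of fun k l =>
    Emean n m v w g θ0 (fun x => svec n m v w g x k * svec n m v w g x l)
      - Emean n m v w g θ0 (fun x => svec n m v w g x k)
          * Emean n m v w g θ0 (fun x => svec n m v w g x l)

/-- Condition (C1): the dyad covariate vectors `S_{j1j2}` (whose entries are `1`, `2`,
`w(v_{j1k}, v_{j2k})`, `g(v_{j1k})` and `g(v_{j2k})`) are uniformly bounded over `n`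
and over dyads, and `θ0` lies in the interior of a compact convex set `Θ ⊂ ℝ^p`. -/
def CondC1 {E : Type*} (m : ℕ) (v : (n : ℕ) → Fin n → Fin m → E)
    (w : E → E → ℝ) (g : E → ℝ) (θ0 : Idx m → ℝ) (Θ : Set (Idx m → ℝ)) : Prop :=
  (∃ B : ℝ, ∀ (n : ℕ) (j1 j2 : Fin n) (k : Fin m),
      |w (v n j1 k) (v n j2 k)| ≤ B ∧ |g (v n j1 k)| ≤ B)
    ∧ IsCompact Θ ∧ Convex ℝ Θ ∧ θ0 ∈ interior Θ

/-- Condition (C2): `N⁻¹ I_N(θ0)` converges, as `n → ∞`, to a positive definite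
matrix `I(θ0)`. -/
def CondC2 {E : Type*} (m : ℕ) (v : (n : ℕ) → Fin n → Fin m → E)
    (w : E → E → ℝ) (g : E → ℝ) (θ0 : Idx m → ℝ)
    (Imat : Matrix (Idx m) (Idx m) ℝ) : Prop :=
  Filter.Tendsto (fun n : ℕ => ((Ndyads n : ℝ))⁻¹ • Ifish n m (v n) w g θ0)
      Filter.atTop (nhds Imat)
    ∧ Imat.PosDef

/-- Expectation of `f` under the Gibbs distribution on `S` with energy `e`. -/
def gibbsMean {α : Type*} (S : Finset α) (e f : α → ℝ) : ℝ :=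
  ∑ a ∈ S, f a * (Real.exp (e a) / ∑ b ∈ S, Real.exp (e b))

/-- Variance of `f` under the Gibbs distribution on `S` with energy `e`. -/
def gibbsVar {α : Type*} (S : Finset α) (e f : α → ℝ) : ℝ :=
  gibbsMean S e fun a => (f a - gibbsMean S e f) ^ 2

/-- Cumulant generating function of the centred statistic `f - E f` under the Gibbs
distribution on `S` with energy `e`. -/
def gibbsCgf {α : Type*} (S : Finset α) (e f : α → ℝ) : ℝ :=
  Real.log (∑ a ∈ S, Real.exp (e a + f a)) - Real.log (∑ a ∈ S, Real.exp (e a))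
    - gibbsMean S e f

section Gibbs

variable {α : Type*} {S : Finset α} {e f : α → ℝ}

lemma sum_exp_pos (hS : S.Nonempty) (e : α → ℝ) : 0 < ∑ a ∈ S, Real.exp (e a) :=
  Finset.sum_pos (fun _ _ => Real.exp_pos _) hS

lemma gibbsMean_mono {f₁ f₂ : α → ℝ} (h : ∀ a ∈ S, f₁ a ≤ f₂ a) :
    gibbsMean S e f₁ ≤ gibbsMean S e f₂ :=
  Finset.sum_le_sum fun a ha => mul_le_mul_of_nonneg_right (h a ha) (by positivity)

lemma gibbsMean_nonneg (h : ∀ a ∈ S, 0 ≤ f a) : 0 ≤ gibbsMean S e f :=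
  Finset.sum_nonneg fun a ha => mul_nonneg (h a ha) (by positivity)

lemma gibbsMean_const (hS : S.Nonempty) (c : ℝ) : gibbsMean S e (fun _ => c) = c := by
  unfold gibbsMean
  rw [← Finset.mul_sum, ← Finset.sum_div, div_self (sum_exp_pos hS e).ne', mul_one]

lemma gibbsMean_add (f₁ f₂ : α → ℝ) :
    gibbsMean S e (fun a => f₁ a + f₂ a) = gibbsMean S e f₁ + gibbsMean S e f₂ := by
  simp only [gibbsMean, add_mul, Finset.sum_add_distrib]

lemma gibbsMean_sub (f₁ f₂ : α → ℝ) :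
    gibbsMean S e (fun a => f₁ a - f₂ a) = gibbsMean S e f₁ - gibbsMean S e f₂ := by
  simp only [gibbsMean, sub_mul, Finset.sum_sub_distrib]

lemma gibbsMean_const_mul (c : ℝ) (f : α → ℝ) :
    gibbsMean S e (fun a => c * f a) = c * gibbsMean S e f := by
  simp only [gibbsMean, mul_assoc, Finset.mul_sum]

lemma gibbsMean_sum {κ : Type*} (s : Finset κ) (F : κ → α → ℝ) :
    gibbsMean S e (fun a => ∑ k ∈ s, F k a) = ∑ k ∈ s, gibbsMean S e (F k) := by
  simp only [gibbsMean, Finset.sum_mul]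
  exact Finset.sum_comm

lemma gibbsMean_centred (hS : S.Nonempty) :
    gibbsMean S e (fun a => f a - gibbsMean S e f) = 0 := by
  rw [gibbsMean_sub, gibbsMean_const hS, sub_self]

lemma abs_gibbsMean_le (hS : S.Nonempty) {R : ℝ} (h : ∀ a ∈ S, |f a| ≤ R) :
    |gibbsMean S e f| ≤ R := by
  refine abs_le.2 ⟨?_, ?_⟩
  · rw [← gibbsMean_const (e := e) hS (-R)]
    exact gibbsMean_mono fun a ha => (abs_le.1 (h a ha)).1
  · rw [← gibbsMean_const (e := e) hS R]
    exact gibbsMean_mono fun a ha => (abs_le.1 (h a ha)).2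

lemma gibbsVar_nonneg : 0 ≤ gibbsVar S e f := gibbsMean_nonneg fun _ _ => sq_nonneg _

lemma gibbsVar_const_mul (c : ℝ) (f : α → ℝ) :
    gibbsVar S e (fun a => c * f a) = c ^ 2 * gibbsVar S e f := by
  rw [gibbsVar, gibbsVar, ← gibbsMean_const_mul (c ^ 2), gibbsMean_const_mul c f]
  exact congrArg (gibbsMean S e) (funext fun a => by ring)

lemma gibbsCgf_eq_log (hS : S.Nonempty) :
    gibbsCgf S e f
      = Real.log (gibbsMean S e fun a => Real.exp (f a - gibbsMean S e f)) := by
  have hZ := sum_exp_pos hS e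
  have hZf := sum_exp_pos hS fun a => e a + f a
  have h : (gibbsMean S e fun a => Real.exp (f a - gibbsMean S e f))
      = (∑ a ∈ S, Real.exp (e a + f a)) / (∑ a ∈ S, Real.exp (e a))
        / Real.exp (gibbsMean S e f) := by
    rw [Finset.sum_div, Finset.sum_div]
    refine Finset.sum_congr rfl fun a _ => ?_
    simp only [Real.exp_sub, Real.exp_add]
    ring
  rw [h, Real.log_div (div_pos hZf hZ).ne' (Real.exp_pos _).ne',
    Real.log_div hZf.ne' hZ.ne', Real.log_exp]
  rfl

lemma gibbsCgf_nonneg (hS : S.Nonempty) : 0 ≤ gibbsCgf S e f := by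
  rw [gibbsCgf_eq_log hS]
  refine Real.log_nonneg ?_
  calc (1 : ℝ) = gibbsMean S e (fun a => (f a - gibbsMean S e f) + 1) := by
        rw [gibbsMean_add, gibbsMean_centred hS, gibbsMean_const hS, zero_add]
    _ ≤ _ := gibbsMean_mono fun a _ => Real.add_one_le_exp _

lemma one_add_add_sq_div_four_le_exp {y : ℝ} (hy : |y| ≤ 1) :
    y + 1 + 1 / 4 * y ^ 2 ≤ Real.exp y := by
  have h := (abs_le.1 (Real.exp_bound hy (n := 3) (by norm_num))).1
  have h3 : |y| ^ 3 ≤ y ^ 2 := by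
    rw [pow_succ, sq_abs]
    exact mul_le_of_le_one_right (sq_nonneg y) hy
  norm_num [Finset.sum_range_succ, Nat.factorial] at h
  nlinarith [sq_nonneg y]

lemma exp_le_one_add_add_sq {y : ℝ} (hy : |y| ≤ 1) : Real.exp y ≤ y + 1 + 1 * y ^ 2 := by
  have h := (abs_le.1 (Real.abs_exp_sub_one_sub_id_le hy)).2
  linarith

lemma gibbsMean_centred_quadratic (hS : S.Nonempty) (c : ℝ) :
    gibbsMean S e (fun a => (f a - gibbsMean S e f) + 1 + c * (f a - gibbsMean S e f) ^ 2)
      = 1 + c * gibbsVar S e f := by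
  rw [gibbsMean_add, gibbsMean_add, gibbsMean_centred hS, gibbsMean_const hS, zero_add,
    gibbsMean_const_mul]
  rfl

lemma gibbsCgf_le_var (hS : S.Nonempty) (hf : ∀ a ∈ S, |f a - gibbsMean S e f| ≤ 1) :
    gibbsCgf S e f ≤ gibbsVar S e f := by
  have h : (gibbsMean S e fun a => Real.exp (f a - gibbsMean S e f))
      ≤ 1 + 1 * gibbsVar S e f := by
    rw [← gibbsMean_centred_quadratic hS]
    exact gibbsMean_mono fun a ha => exp_le_one_add_add_sq (hf a ha)
  have hpos : 0 < gibbsMean S e fun a => Real.exp (f a - gibbsMean S e f) :=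
    Finset.sum_pos (fun a _ => mul_pos (Real.exp_pos _)
      (div_pos (Real.exp_pos _) (sum_exp_pos hS e))) hS
  rw [gibbsCgf_eq_log hS]
  linarith [Real.log_le_sub_one_of_pos hpos]

lemma var_div_five_le_gibbsCgf (hS : S.Nonempty)
    (hf : ∀ a ∈ S, |f a - gibbsMean S e f| ≤ 1) :
    gibbsVar S e f / 5 ≤ gibbsCgf S e f := by
  have hV0 : 0 ≤ gibbsVar S e f := gibbsVar_nonneg
  have hV1 : gibbsVar S e f ≤ 1 := by
    rw [← gibbsMean_const (e := e) hS 1]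
    exact gibbsMean_mono fun a ha => (sq_le_one_iff_abs_le_one _).2 (hf a ha)
  have h : 1 + 1 / 4 * gibbsVar S e f
      ≤ gibbsMean S e fun a => Real.exp (f a - gibbsMean S e f) := by
    rw [← gibbsMean_centred_quadratic hS]
    exact gibbsMean_mono fun a ha => one_add_add_sq_div_four_le_exp (hf a ha)
  rw [gibbsCgf_eq_log hS]
  set V := gibbsVar S e f
  have hpos : 0 < 1 + 1 / 4 * V := by positivity
  refine le_trans ?_ (Real.log_le_log hpos h)
  refine le_trans ?_ (Real.one_sub_inv_le_log_of_pos hpos)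
  rw [div_le_iff₀ (by norm_num), inv_eq_one_div, ← sub_nonneg]
  have : (1 - 1 / (1 + 1 / 4 * V)) * 5 - V = V * (1 - V) / (4 * (1 + 1 / 4 * V)) := by
    field_simp
    ring
  rw [this]
  exact div_nonneg (mul_nonneg hV0 (by linarith)) (by positivity)

/-- If the partition function factorizes along the line `e + t f`, the cumulant generating
function and the variance of `f` are comparable as soon as each factor of `f` is bounded. -/
lemma gibbsCgf_bounds_of_factorization {ι β : Type*} {Q : Finset ι} {T : Finset β}
    {eQ fQ : ι → β → ℝ} (hS : S.Nonempty) (hT : T.Nonempty)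
    (hfac : ∀ t : ℝ, ∑ a ∈ S, Real.exp (e a + t * f a)
      = ∏ q ∈ Q, ∑ b ∈ T, Real.exp (eQ q b + t * fQ q b))
    (hb : ∀ q ∈ Q, ∀ b ∈ T, |fQ q b - gibbsMean T (eQ q) (fQ q)| ≤ 1) :
    gibbsVar S e f / 25 ≤ gibbsCgf S e f ∧ gibbsCgf S e f ≤ 5 * gibbsVar S e f := by
  obtain ⟨R, hR1, hR⟩ : ∃ R : ℝ, 1 ≤ R ∧ ∀ a ∈ S, |f a - gibbsMean S e f| ≤ R := by
    refine ⟨1 + ∑ a ∈ S, |f a - gibbsMean S e f|,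
      le_add_of_nonneg_right (Finset.sum_nonneg fun _ _ => abs_nonneg _), fun a ha => ?_⟩
    have := Finset.single_le_sum (f := fun a => |f a - gibbsMean S e f|)
      (fun _ _ => abs_nonneg _) ha
    linarith
  have hRpos : 0 < R := by linarith
  set δ := gibbsMean S e f - ∑ q ∈ Q, gibbsMean T (eQ q) (fQ q) with hδ
  set V := gibbsVar S e f
  set VQ := ∑ q ∈ Q, gibbsVar T (eQ q) (fQ q)
  have hVQ0 : 0 ≤ VQ := Finset.sum_nonneg fun _ _ => gibbsVar_nonneg
  have hV0 : 0 ≤ V := gibbsVar_nonneg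
  have hlog : ∀ t : ℝ, Real.log (∑ a ∈ S, Real.exp (e a + t * f a))
      = ∑ q ∈ Q, Real.log (∑ b ∈ T, Real.exp (eQ q b + t * fQ q b)) := fun t => by
    rw [hfac, Real.log_prod fun q _ => (sum_exp_pos hT _).ne']
  have hsum : ∀ t : ℝ, ∑ q ∈ Q, gibbsCgf T (eQ q) (fun b => t * fQ q b)
      = gibbsCgf S e (fun a => t * f a) + t * δ := fun t => by
    have h0 := hlog 0
    simp only [zero_mul, add_zero] at h0
    simp only [gibbsCgf, gibbsMean_const_mul, Finset.sum_sub_distrib, hlog t, h0,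
      ← Finset.mul_sum, hδ]
    ring
  have hQ : ∀ t : ℝ, 0 ≤ t → t ≤ 1 →
      t ^ 2 * VQ / 5 ≤ ∑ q ∈ Q, gibbsCgf T (eQ q) (fun b => t * fQ q b) ∧
      ∑ q ∈ Q, gibbsCgf T (eQ q) (fun b => t * fQ q b) ≤ t ^ 2 * VQ := fun t ht0 ht1 => by
    have hbt : ∀ q ∈ Q, ∀ b ∈ T,
        |t * fQ q b - gibbsMean T (eQ q) (fun b => t * fQ q b)| ≤ 1 := fun q hq b hbT => by
      rw [gibbsMean_const_mul, ← mul_sub, abs_mul, abs_of_nonneg ht0]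
      exact mul_le_one₀ ht1 (abs_nonneg _) (hb q hq b hbT)
    constructor
    · rw [Finset.mul_sum, Finset.sum_div]
      refine Finset.sum_le_sum fun q hq => ?_
      rw [← gibbsVar_const_mul]
      exact var_div_five_le_gibbsCgf hT (hbt q hq)
    · rw [Finset.mul_sum]
      refine Finset.sum_le_sum fun q hq => ?_
      rw [← gibbsVar_const_mul]
      exact gibbsCgf_le_var hT (hbt q hq)
  have hF : ∀ t : ℝ, 0 ≤ t → t ≤ 1 / R →
      t ^ 2 * V / 5 ≤ gibbsCgf S e (fun a => t * f a) ∧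
      gibbsCgf S e (fun a => t * f a) ≤ t ^ 2 * V := fun t ht0 ht1 => by
    have hbt : ∀ a ∈ S, |t * f a - gibbsMean S e (fun a => t * f a)| ≤ 1 := fun a ha => by
      rw [gibbsMean_const_mul, ← mul_sub, abs_mul, abs_of_nonneg ht0]
      calc t * |f a - gibbsMean S e f| ≤ 1 / R * R :=
            mul_le_mul ht1 (hR a ha) (abs_nonneg _) (by positivity)
        _ = 1 := by field_simp
    rw [← gibbsVar_const_mul]
    exact ⟨var_div_five_le_gibbsCgf hS hbt, gibbsCgf_le_var hS hbt⟩
  have hRinv : 1 / R ≤ 1 := by rw [div_le_one hRpos]; exact hR1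
  have hδ0 : δ = 0 := by
    rw [← abs_nonpos_iff]
    refine le_of_forall_pos_le_add fun η hη => ?_
    set t := min (1 / R) (η / (V + VQ + 1)) with ht
    have htpos : 0 < t := lt_min (by positivity) (by positivity)
    have htR : t ≤ 1 / R := min_le_left _ _
    have htη : t * (V + VQ + 1) ≤ η := by
      rw [← le_div_iff₀ (by positivity)]
      exact min_le_right _ _
    have h1 := hF t htpos.le htR
    have h2 := hQ t htpos.le (htR.trans hRinv)
    rw [hsum t] at h2
    have h3 : 0 ≤ t ^ 2 * V := by positivity
    have h4 : 0 ≤ t ^ 2 * VQ := by positivity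
    have h5 : t * |δ| ≤ t * (t * (V + VQ)) := by
      rw [← abs_of_pos htpos, ← abs_mul, abs_of_pos htpos]
      exact abs_le.2 ⟨by nlinarith, by nlinarith⟩
    have h6 := le_of_mul_le_mul_left h5 htpos
    linarith
  have hR0 : 0 < (1 / R) ^ 2 := by positivity
  have h1 := hF (1 / R) (by positivity) le_rfl
  have h2 := hQ (1 / R) (by positivity) hRinv
  have h3 := hQ 1 zero_le_one le_rfl
  rw [hsum, hδ0] at h2 h3
  simp only [one_mul, mul_zero, add_zero, one_pow] at h2 h3
  have h4 : V / 5 ≤ VQ := le_of_mul_le_mul_left (by linarith [h1.1, h2.2]) hR0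
  have h5 : VQ / 5 ≤ V := le_of_mul_le_mul_left (by linarith [h1.2, h2.1]) hR0
  exact ⟨by linarith [h3.1], by linarith [h3.2]⟩

end Gibbs

section Dyads

/-- The contribution of a single dyad in state `b` to the vector of sufficient statistics. -/
def dyadStat {m : ℕ} (w : E → E → ℝ) (g : E → ℝ) (v₁ v₂ : Fin m → E) (b : Bool × Bool) :
    Idx m → ℝ
  | Sum.inl i => if i = 0 then bval b.1 * bval b.2 else bval b.1 + bval b.2
  | Sum.inr (Sum.inl k) => (bval b.1 + bval b.2) * w (v₁ k) (v₂ k)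
  | Sum.inr (Sum.inr (Sum.inl k)) => bval b.1 * g (v₁ k) + bval b.2 * g (v₂ k)
  | Sum.inr (Sum.inr (Sum.inr k)) => bval b.1 * g (v₂ k) + bval b.2 * g (v₁ k)

lemma abs_bval_le (b : Bool) : |bval b| ≤ 1 := by cases b <;> simp [bval]

lemma abs_bval_mul_add_le {B s t : ℝ} (hs : |s| ≤ B) (ht : |t| ≤ B) (a b : Bool) :
    |bval a * s + bval b * t| ≤ 2 * B := by
  have h1 : |bval a * s| ≤ B := by
    rw [abs_mul]
    exact (mul_le_of_le_one_left (abs_nonneg s) (abs_bval_le a)).trans hs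
  have h2 : |bval b * t| ≤ B := by
    rw [abs_mul]
    exact (mul_le_of_le_one_left (abs_nonneg t) (abs_bval_le b)).trans ht
  linarith [abs_add_le (bval a * s) (bval b * t)]

lemma abs_dyadStat_le {m : ℕ} {w : E → E → ℝ} {g : E → ℝ} {v₁ v₂ : Fin m → E} {B : ℝ}
    (hB : 1 ≤ B) (hw : ∀ k, |w (v₁ k) (v₂ k)| ≤ B) (hg₁ : ∀ k, |g (v₁ k)| ≤ B)
    (hg₂ : ∀ k, |g (v₂ k)| ≤ B) (b : Bool × Bool) (i : Idx m) :
    |dyadStat w g v₁ v₂ b i| ≤ 2 * B := by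
  have h1 : |(1 : ℝ)| ≤ B := by simpa using hB
  rcases i with i | k | k | k
  · simp only [dyadStat]
    split_ifs
    · rw [abs_mul]
      have := mul_le_one₀ (abs_bval_le b.1) (abs_nonneg _) (abs_bval_le b.2)
      linarith
    · simpa using abs_bval_mul_add_le h1 h1 b.1 b.2
  · simp only [dyadStat, add_mul]
    exact abs_bval_mul_add_le (hw k) (hw k) b.1 b.2
  · exact abs_bval_mul_add_le (hg₁ k) (hg₂ k) b.1 b.2
  · exact abs_bval_mul_add_le (hg₂ k) (hg₁ k) b.1 b.2

lemma sum_pairsNE {n : ℕ} (φ : Fin n × Fin n → ℝ) :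
    ∑ q ∈ pairsNE n, φ q = ∑ q ∈ pairsLT n, (φ q + φ q.swap) := by
  simp only [pairsNE, pairsLT, Finset.sum_filter]
  have hswap : ∑ q : Fin n × Fin n, (if q.1 < q.2 then φ q.swap else 0)
      = ∑ q : Fin n × Fin n, (if q.2 < q.1 then φ q else 0) :=
    (Equiv.prodComm (Fin n) (Fin n)).sum_comp fun q => if q.2 < q.1 then φ q else 0
  have hsplit : ∑ q : Fin n × Fin n, (if q.1 < q.2 then φ q + φ q.swap else 0)
      = ∑ q : Fin n × Fin n, (if q.1 < q.2 then φ q else 0)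
        + ∑ q : Fin n × Fin n, (if q.1 < q.2 then φ q.swap else 0) := by
    rw [← Finset.sum_add_distrib]
    exact Finset.sum_congr rfl fun q _ => by split_ifs <;> simp
  rw [hsplit, hswap, ← Finset.sum_add_distrib]
  refine Finset.sum_congr rfl fun q _ => ?_
  rcases lt_trichotomy q.1 q.2 with h | h | h
  · simp [h, h.ne, h.not_gt]
  · simp [h]
  · simp [h, h.ne', h.not_gt]

lemma svec_eq_sum_dyadStat {n m : ℕ} {v : Fin n → Fin m → E} {w : E → E → ℝ} {g : E → ℝ}
    (hw : ∀ u u' : E, w u u' = w u' u) (x : Fin n → Fin n → Bool) (i : Idx m) :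
    svec n m v w g x i
      = ∑ q ∈ pairsLT n, dyadStat w g (v q.1) (v q.2) (x q.1 q.2, x q.2 q.1) i := by
  rcases i with i | k | k | k
  · simp only [svec, dyadStat]
    split_ifs
    · rfl
    · rw [sum_pairsNE]
      rfl
  · simp only [svec, dyadStat]
    rw [sum_pairsNE]
    refine Finset.sum_congr rfl fun q _ => ?_
    simp only [Prod.fst_swap, Prod.snd_swap]
    rw [hw (v q.2 k) (v q.1 k)]
    ring
  · simp only [svec, dyadStat]
    rw [sum_pairsNE]
    rfl
  · simp only [svec, dyadStat]
    rw [sum_pairsNE]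
    rfl

lemma Hvec_eq_sum_dyadStat {n m : ℕ} {v : Fin n → Fin m → E} {w : E → E → ℝ} {g : E → ℝ}
    (hw : ∀ u u' : E, w u u' = w u' u) (θ : Idx m → ℝ) (x : Fin n → Fin n → Bool) :
    Hvec n m v w g θ x
      = ∑ q ∈ pairsLT n,
          ∑ i, θ i * dyadStat w g (v q.1) (v q.2) (x q.1 q.2, x q.2 q.1) i := by
  simp only [Hvec, svec_eq_sum_dyadStat hw, Finset.mul_sum]
  exact Finset.sum_comm

lemma nets_nonempty (n : ℕ) : (nets n).Nonempty :=
  ⟨fun _ _ => false, by simp [nets]⟩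

/-- A sum over networks of a product over dyads factorizes. -/
lemma sum_nets_prod {n : ℕ} (φ : Fin n × Fin n → Bool × Bool → ℝ) :
    ∑ x ∈ nets n, ∏ q ∈ pairsLT n, φ q (x q.1 q.2, x q.2 q.1)
      = ∏ q ∈ pairsLT n, ∑ b, φ q b := by
  have hmem : ∀ {i j : Fin n}, (i, j) ∈ pairsLT n ↔ i < j := by simp [pairsLT]
  rw [← Finset.prod_coe_sort (pairsLT n) fun q => ∑ b, φ q b, Finset.prod_univ_sum]
  refine Finset.sum_bij'
    (fun x _ (q : pairsLT n) => (x q.1.1 q.1.2, x q.1.2 q.1.1))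
    (fun y _ i j => if h : i < j then (y ⟨(i, j), hmem.2 h⟩).1
      else if h : j < i then (y ⟨(j, i), hmem.2 h⟩).2 else false)
    (fun _ _ => by simp) (fun _ _ => by simp [nets]) ?_ ?_ ?_
  · intro x hx
    have hd : ∀ j, x j j = false := by simpa [nets] using hx
    funext i j
    rcases lt_trichotomy i j with h | h | h
    · simp [h]
    · simp [h, hd]
    · simp [h, h.not_gt]
  · intro y _
    funext ⟨⟨i, j⟩, hq⟩
    have h : i < j := hmem.1 hq
    simp [h, h.not_gt]
  · intro x _
    exact (Finset.prod_coe_sort (pairsLT n) fun q => φ q (x q.1 q.2, x q.2 q.1)).symm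

lemma sum_nets_exp_Hvec {n m : ℕ} {v : Fin n → Fin m → E} {w : E → E → ℝ} {g : E → ℝ}
    (hw : ∀ u u' : E, w u u' = w u' u) (θ u : Idx m → ℝ) (t : ℝ) :
    ∑ x ∈ nets n, Real.exp (Hvec n m v w g θ x + t * Hvec n m v w g u x)
      = ∏ q ∈ pairsLT n, ∑ b,
          Real.exp (∑ i, θ i * dyadStat w g (v q.1) (v q.2) b i
            + t * ∑ i, u i * dyadStat w g (v q.1) (v q.2) b i) := by
  rw [← sum_nets_prod]
  refine Finset.sum_congr rfl fun x _ => ?_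
  rw [← Real.exp_sum, Hvec_eq_sum_dyadStat hw θ, Hvec_eq_sum_dyadStat hw u, Finset.mul_sum,
    Finset.sum_add_distrib]

lemma abs_sum_mul_le_norm {ι : Type*} [Fintype ι] (u d : ι → ℝ) :
    |∑ i, u i * d i| ≤ ‖u‖ * ∑ i, |d i| := by
  refine (Finset.abs_sum_le_sum_abs _ _).trans ?_
  rw [Finset.mul_sum]
  refine Finset.sum_le_sum fun i _ => ?_
  rw [abs_mul]
  exact mul_le_mul_of_nonneg_right (norm_le_pi_norm u i) (abs_nonneg _)

/-- The cumulant generating function of the sufficient statistic is comparable to its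
variance in a neighbourhood of the origin whose size does not depend on `n`. -/
lemma gibbsCgf_Hvec_bounds {n m : ℕ} {v : Fin n → Fin m → E} {w : E → E → ℝ} {g : E → ℝ}
    (hw : ∀ u u' : E, w u u' = w u' u) {B : ℝ} (hB1 : 1 ≤ B)
    (hB : ∀ (j1 j2 : Fin n) (k : Fin m), |w (v j1 k) (v j2 k)| ≤ B ∧ |g (v j1 k)| ≤ B)
    (θ u : Idx m → ℝ) (hu : ‖u‖ * (4 * B * Fintype.card (Idx m)) ≤ 1) :
    gibbsVar (nets n) (Hvec n m v w g θ) (Hvec n m v w g u) / 25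
        ≤ gibbsCgf (nets n) (Hvec n m v w g θ) (Hvec n m v w g u) ∧
      gibbsCgf (nets n) (Hvec n m v w g θ) (Hvec n m v w g u)
        ≤ 5 * gibbsVar (nets n) (Hvec n m v w g θ) (Hvec n m v w g u) := by
  refine gibbsCgf_bounds_of_factorization (Q := pairsLT n)
    (T := (Finset.univ : Finset (Bool × Bool)))
    (eQ := fun q b => ∑ i, θ i * dyadStat w g (v q.1) (v q.2) b i)
    (fQ := fun q b => ∑ i, u i * dyadStat w g (v q.1) (v q.2) b i)
    (nets_nonempty n) Finset.univ_nonempty (sum_nets_exp_Hvec hw θ u) fun q _ b _ => ?_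
  have hbound : ∀ b ∈ (Finset.univ : Finset (Bool × Bool)),
      |∑ i, u i * dyadStat w g (v q.1) (v q.2) b i| ≤ 1 / 2 := fun b _ => by
    refine (abs_sum_mul_le_norm _ _).trans ?_
    have hsum : ∑ i, |dyadStat w g (v q.1) (v q.2) b i| ≤ Fintype.card (Idx m) * (2 * B) := by
      refine (Finset.sum_le_card_nsmul _ _ (2 * B) fun i _ => abs_dyadStat_le hB1
        (fun k => (hB q.1 q.2 k).1) (fun k => (hB q.1 q.2 k).2)
        (fun k => (hB q.2 q.2 k).2) b i).trans_eq ?_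
      rw [nsmul_eq_mul]
      rfl
    have := mul_le_mul_of_nonneg_left hsum (norm_nonneg u)
    linarith
  have h1 := hbound b (Finset.mem_univ b)
  have h2 := abs_gibbsMean_le
    (e := fun b => ∑ i, θ i * dyadStat w g (v q.1) (v q.2) b i) Finset.univ_nonempty hbound
  exact (abs_sub _ _).trans (by linarith)

end Dyads

section Likelihood

variable {n m : ℕ} {v : Fin n → Fin m → E} {w : E → E → ℝ} {g : E → ℝ}

lemma Hvec_add (θ u : Idx m → ℝ) (x : Fin n → Fin n → Bool) :
    Hvec n m v w g (θ + u) x = Hvec n m v w g θ x + Hvec n m v w g u x := by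
  simp [Hvec, add_mul, Finset.sum_add_distrib]

/-- The score `∇ L_N(θ)`. -/
def score (n m : ℕ) (v : Fin n → Fin m → E) (w : E → E → ℝ) (g : E → ℝ) (θ : Idx m → ℝ)
    (x : Fin n → Fin n → Bool) (i : Idx m) : ℝ :=
  svec n m v w g x i - Emean n m v w g θ (fun y => svec n m v w g y i)

lemma Hvec_sub_mean (θ u : Idx m → ℝ) (x : Fin n → Fin n → Bool) :
    Hvec n m v w g u x - gibbsMean (nets n) (Hvec n m v w g θ) (Hvec n m v w g u)
      = ∑ i, u i * score n m v w g θ x i := by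
  have h : gibbsMean (nets n) (Hvec n m v w g θ) (Hvec n m v w g u)
      = ∑ i, u i * Emean n m v w g θ (fun y => svec n m v w g y i) := by
    refine (gibbsMean_sum _ fun i y => u i * svec n m v w g y i).trans ?_
    exact Finset.sum_congr rfl fun i _ => gibbsMean_const_mul _ _
  rw [h]
  simp only [Hvec, score, mul_sub, Finset.sum_sub_distrib]

lemma neg_Llik_add_sub (θ u : Idx m → ℝ) (x : Fin n → Fin n → Bool) :
    -Llik n m v w g (θ + u) x - -Llik n m v w g θ x
      = gibbsCgf (nets n) (Hvec n m v w g θ) (Hvec n m v w g u)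
        - ∑ i, u i * score n m v w g θ x i := by
  rw [← Hvec_sub_mean]
  simp only [Llik, Zvec, gibbsCgf, Hvec_add]
  ring

lemma convexOn_neg_Llik (x : Fin n → Fin n → Bool) :
    ConvexOn ℝ Set.univ fun θ => -Llik n m v w g θ x := by
  refine ⟨convex_univ, fun a _ b _ s t hs ht hst => ?_⟩
  set c := s • a + t • b with hc
  have htangent : ∀ θ, -(∑ i, (θ i - c i) * score n m v w g c x i)
      ≤ -Llik n m v w g θ x - -Llik n m v w g c x := fun θ => by
    have h := neg_Llik_add_sub (v := v) (w := w) (g := g) c (θ - c) x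
    rw [add_sub_cancel] at h
    rw [h]
    have := gibbsCgf_nonneg (e := Hvec n m v w g c) (f := Hvec n m v w g (θ - c))
      (nets_nonempty n)
    simp only [Pi.sub_apply]
    linarith
  have h0 : s * ∑ i, (a i - c i) * score n m v w g c x i
      + t * ∑ i, (b i - c i) * score n m v w g c x i = 0 := by
    rw [Finset.mul_sum, Finset.mul_sum, ← Finset.sum_add_distrib]
    refine Finset.sum_eq_zero fun i _ => ?_
    have hci : c i = s * a i + t * b i := by simp [hc]
    have hs1 : s = 1 - t := by linarith
    rw [hci, hs1]
    ring
  have ha := mul_le_mul_of_nonneg_left (htangent a) hs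
  have hb := mul_le_mul_of_nonneg_left (htangent b) ht
  have hL : s * Llik n m v w g c x + t * Llik n m v w g c x = Llik n m v w g c x := by
    rw [← add_mul, hst, one_mul]
  simp only [smul_eq_mul]
  linarith

lemma gibbsMean_score_mul_score (θ : Idx m → ℝ) (k l : Idx m) :
    gibbsMean (nets n) (Hvec n m v w g θ)
        (fun x => score n m v w g θ x k * score n m v w g θ x l)
      = Ifish n m v w g θ k l := by
  set μ : Idx m → ℝ := fun i => Emean n m v w g θ (fun y => svec n m v w g y i) with hμ
  have h : (fun x => score n m v w g θ x k * score n m v w g θ x l)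
      = fun x => (svec n m v w g x k * svec n m v w g x l
          - (μ k * svec n m v w g x l + μ l * svec n m v w g x k)) + μ k * μ l := by
    funext x
    simp only [score, hμ]
    ring
  rw [h, gibbsMean_add, gibbsMean_sub, gibbsMean_add, gibbsMean_const_mul, gibbsMean_const_mul,
    gibbsMean_const (nets_nonempty n)]
  change Emean n m v w g θ _ - (μ k * μ l + μ l * μ k) + μ k * μ l
    = Emean n m v w g θ _ - μ k * μ l
  ring

lemma gibbsVar_Hvec (θ u : Idx m → ℝ) :
    gibbsVar (nets n) (Hvec n m v w g θ) (Hvec n m v w g u)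
      = ∑ k, ∑ l, u k * u l * Ifish n m v w g θ k l := by
  have h : (fun x => (Hvec n m v w g u x
        - gibbsMean (nets n) (Hvec n m v w g θ) (Hvec n m v w g u)) ^ 2)
      = fun x => ∑ k, ∑ l, u k * u l * (score n m v w g θ x k * score n m v w g θ x l) := by
    funext x
    rw [Hvec_sub_mean, sq, Finset.sum_mul_sum]
    exact Finset.sum_congr rfl fun k _ => Finset.sum_congr rfl fun l _ => by ring
  rw [gibbsVar, h, gibbsMean_sum]
  simp only [gibbsMean_sum, gibbsMean_const_mul, gibbsMean_score_mul_score]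

end Likelihood

section QuadraticForms

variable {ι : Type*} [Fintype ι]

lemma abs_quadForm_le (A : Matrix ι ι ℝ) (u : ι → ℝ) :
    |∑ k, ∑ l, u k * u l * A k l| ≤ ‖u‖ ^ 2 * ∑ k, ∑ l, |A k l| := by
  refine (Finset.abs_sum_le_sum_abs _ _).trans ?_
  rw [Finset.mul_sum]
  refine Finset.sum_le_sum fun k _ => (Finset.abs_sum_le_sum_abs _ _).trans ?_
  rw [Finset.mul_sum]
  refine Finset.sum_le_sum fun l _ => ?_
  rw [abs_mul, abs_mul, sq]
  exact mul_le_mul_of_nonneg_right (mul_le_mul (norm_le_pi_norm u k) (norm_le_pi_norm u l)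
    (abs_nonneg _) (norm_nonneg _)) (abs_nonneg _)

lemma Matrix.PosDef.exists_mul_norm_sq_le [Nonempty ι] {A : Matrix ι ι ℝ} (hA : A.PosDef) :
    ∃ c > 0, ∀ u : ι → ℝ, c * ‖u‖ ^ 2 ≤ ∑ k, ∑ l, u k * u l * A k l := by
  have hpos : ∀ u : ι → ℝ, u ≠ 0 → 0 < ∑ k, ∑ l, u k * u l * A k l := fun u hu => by
    have h := hA.dotProduct_mulVec_pos hu
    simp only [star_trivial, dotProduct, Matrix.mulVec, Finset.mul_sum] at h
    exact h.trans_eq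
      (Finset.sum_congr rfl fun k _ => Finset.sum_congr rfl fun l _ => by ring)
  obtain ⟨u₀, hu₀, hmin⟩ := (isCompact_sphere (0 : ι → ℝ) 1).exists_isMinOn
    (NormedSpace.sphere_nonempty.2 zero_le_one)
    (f := fun u : ι → ℝ => ∑ k, ∑ l, u k * u l * A k l) (by fun_prop)
  have hu₀' : u₀ ≠ 0 := by
    rintro rfl
    simp at hu₀
  refine ⟨_, hpos u₀ hu₀', fun u => ?_⟩
  rcases eq_or_ne u 0 with rfl | hu
  · simp
  have hn : 0 < ‖u‖ := norm_pos_iff.2 hu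
  have hmem : ‖u‖⁻¹ • u ∈ Metric.sphere (0 : ι → ℝ) 1 := by
    simp [norm_smul, hn.ne']
  have h := isMinOn_iff.1 hmin _ hmem
  have hscale : ∑ k, ∑ l, (‖u‖⁻¹ • u) k * (‖u‖⁻¹ • u) l * A k l
      = (∑ k, ∑ l, u k * u l * A k l) / ‖u‖ ^ 2 := by
    simp only [Pi.smul_apply, smul_eq_mul, Finset.sum_div]
    exact Finset.sum_congr rfl fun k _ => Finset.sum_congr rfl fun l _ => by
      field_simp
  rw [hscale, le_div_iff₀ (by positivity)] at h
  exact h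

/-- If `a_n⁻¹ A_n` converges to a positive definite matrix, the quadratic form of `A_n` is
eventually comparable to `a_n ‖u‖²`. -/
lemma eventually_quadForm_bounds [Nonempty ι] {A : ℕ → Matrix ι ι ℝ} {a : ℕ → ℝ}
    {L : Matrix ι ι ℝ} (hL : L.PosDef) (ha : ∀ᶠ n in Filter.atTop, 0 < a n)
    (h : Filter.Tendsto (fun n => (a n)⁻¹ • A n) Filter.atTop (nhds L)) :
    ∃ c > 0, ∃ C > 0, ∀ᶠ n in Filter.atTop, ∀ u : ι → ℝ,
      c * (a n * ‖u‖ ^ 2) ≤ ∑ k, ∑ l, u k * u l * A n k l ∧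
      ∑ k, ∑ l, u k * u l * A n k l ≤ C * (a n * ‖u‖ ^ 2) := by
  obtain ⟨c, hc, hcL⟩ := hL.exists_mul_norm_sq_le
  have hdiff : Filter.Tendsto (fun n => ∑ k, ∑ l, |((a n)⁻¹ • A n - L) k l|)
      Filter.atTop (nhds 0) := by
    have hcont : Continuous fun M : Matrix ι ι ℝ => ∑ k, ∑ l, |(M - L) k l| := by
      simp only [Matrix.sub_apply]
      fun_prop
    simpa [Function.comp_def] using (hcont.tendsto L).comp h
  refine ⟨c / 2, by positivity, ∑ k, ∑ l, |L k l| + c / 2, by positivity, ?_⟩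
  filter_upwards [ha, hdiff.eventually_le_const (half_pos hc)] with n hn hd u
  have hsplit : ∑ k, ∑ l, u k * u l * A n k l
      = a n * (∑ k, ∑ l, u k * u l * L k l
        + ∑ k, ∑ l, u k * u l * ((a n)⁻¹ • A n - L) k l) := by
    simp only [← Finset.sum_add_distrib, Finset.mul_sum, Matrix.sub_apply, Matrix.smul_apply,
      smul_eq_mul]
    refine Finset.sum_congr rfl fun k _ => Finset.sum_congr rfl fun l _ => ?_
    field_simp
    ring
  have h1 := (abs_le.1 (abs_quadForm_le L u)).2
  have h2 := abs_le.1 ((abs_quadForm_le ((a n)⁻¹ • A n - L) u).trans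
    (mul_le_mul_of_nonneg_left hd (by positivity)))
  have h3 := hcL u
  rw [hsplit]
  constructor
  · rw [mul_left_comm]
    exact mul_le_mul_of_nonneg_left (by linarith [h2.1]) hn.le
  · rw [mul_left_comm]
    exact mul_le_mul_of_nonneg_left (by linarith [h2.2]) hn.le

end QuadraticForms

section Deterministic

variable {ι : Type*} [Fintype ι]

/-- A minimizer of the penalized criterion lies in a ball of radius `ρ / r` around `θ0`. -/
lemma norm_sub_lt_of_penalized_minimizer {f : (ι → ℝ) → ℝ} (hf : ConvexOn ℝ Set.univ f)
    {θ0 θhat : ι → ℝ} {pen : ι → ℝ} (hpen : ∀ k, 0 ≤ pen k) {r ρ c M : ℝ} (hr : 0 < r)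
    (hρ : 0 < ρ) (hcρ : M + 1 < c * ρ)
    (hlow : ∀ u, ‖u‖ = ρ / r →
      c * (r ^ 2 * ‖u‖ ^ 2) - M * (r * ‖u‖) ≤ f (θ0 + u) - f θ0)
    (hact : ∀ k, θ0 k ≠ 0 → Fintype.card ι * pen k ≤ r)
    (hmin : f θhat + ∑ k, pen k * |θhat k| ≤ f θ0 + ∑ k, pen k * |θ0 k|) :
    ‖θhat - θ0‖ < ρ / r := by
  by_contra! hfar
  have hρr : 0 < ρ / r := by positivity
  have hd : 0 < ‖θhat - θ0‖ := hρr.trans_le hfar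
  set t := ρ / r / ‖θhat - θ0‖ with ht
  have ht0 : 0 ≤ t := by positivity
  have ht1 : t ≤ 1 := (div_le_one hd).2 hfar
  set u := t • (θhat - θ0) with hu
  have hun : ‖u‖ = ρ / r := by
    rw [hu, norm_smul, Real.norm_of_nonneg ht0, ht, div_mul_cancel₀ _ hd.ne']
  have hcomb : θ0 + u = (1 - t) • θ0 + t • θhat := by
    rw [hu]
    module
  have hconv : f (θ0 + u) ≤ (1 - t) * f θ0 + t * f θhat := by
    rw [hcomb]
    exact hf.2 (Set.mem_univ _) (Set.mem_univ _) (by linarith) ht0 (by ring)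
  have hpenconv : ∑ k, pen k * |(θ0 + u) k|
      ≤ (1 - t) * ∑ k, pen k * |θ0 k| + t * ∑ k, pen k * |θhat k| := by
    rw [Finset.mul_sum, Finset.mul_sum, ← Finset.sum_add_distrib]
    refine Finset.sum_le_sum fun k _ => ?_
    have : |(θ0 + u) k| ≤ (1 - t) * |θ0 k| + t * |θhat k| := by
      rw [hcomb]
      refine (abs_add_le _ _).trans_eq ?_
      simp [abs_mul, abs_of_nonneg ht0, abs_of_nonneg (sub_nonneg.2 ht1)]
    exact (mul_le_mul_of_nonneg_left this (hpen k)).trans_eq (by ring)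
  have hpenlow : -ρ ≤ ∑ k, pen k * |(θ0 + u) k| - ∑ k, pen k * |θ0 k| := by
    rw [← Finset.sum_sub_distrib]
    have hcard : ∑ _k : ι, -(ρ / Fintype.card ι) ≥ -ρ := by
      rw [Finset.sum_const, nsmul_eq_mul, Finset.card_univ]
      rcases isEmpty_or_nonempty ι with h | h
      · simp [hρ.le]
      · have : (Fintype.card ι : ℝ) ≠ 0 := by simp
        field_simp
        exact le_rfl
    refine le_trans hcard (Finset.sum_le_sum fun k _ => ?_)
    have : Nonempty ι := ⟨k⟩
    have hp : (0 : ℝ) < Fintype.card ι := by exact_mod_cast Fintype.card_pos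
    by_cases hk : θ0 k = 0
    · have h1 : 0 ≤ pen k * |(θ0 + u) k| := mul_nonneg (hpen k) (abs_nonneg _)
      have h2 : 0 ≤ ρ / Fintype.card ι := by positivity
      simp only [hk, abs_zero, mul_zero, sub_zero]
      linarith
    · have habs : -(ρ / r) ≤ |(θ0 + u) k| - |θ0 k| := by
        have h1 : |u k| ≤ ρ / r := hun ▸ norm_le_pi_norm u k
        have h2 := abs_sub_abs_le_abs_sub (θ0 k) ((θ0 + u) k)
        have h3 : |θ0 k - (θ0 + u) k| = |u k| := by simp
        linarith
      have hpk : pen k * (ρ / r) ≤ ρ / Fintype.card ι := by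
        rw [le_div_iff₀ hp]
        have := mul_le_mul_of_nonneg_right (hact k hk) hρr.le
        rw [mul_div_cancel₀ _ hr.ne'] at this
        linarith
      have := mul_le_mul_of_nonneg_left habs (hpen k)
      linarith
  have h := hlow u hun
  have hr1 : r * ‖u‖ = ρ := by rw [hun, mul_div_cancel₀ _ hr.ne']
  rw [← mul_pow, hr1] at h
  have hgain : f θhat + ∑ k, pen k * |θhat k| - (f θ0 + ∑ k, pen k * |θ0 k|) ≤ 0 := by
    linarith
  have := mul_nonpos_of_nonneg_of_nonpos ht0 hgain
  nlinarith

/-- Deterministic core of selection consistency: on the event where the score is of order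
`r`, the active penalties are small and the inactive ones are large relative to `r`, a
penalized minimizer vanishes on the inactive coordinates. -/
lemma penalized_minimizer_eq_zero {f : (ι → ℝ) → ℝ} (hf : ConvexOn ℝ Set.univ f)
    {Θ : Set (ι → ℝ)} {θ0 θhat : ι → ℝ} {pen : ι → ℝ} (hpen : ∀ k, 0 ≤ pen k)
    {r ρ c C M : ℝ} (hr : 0 < r) (hρ : 0 < ρ) (hc : 0 ≤ c) (hC : 0 ≤ C) (hM : 0 ≤ M)
    (hcρ : M + 1 < c * ρ)
    (hlow : ∀ u, ‖u‖ ≤ (ρ + 1) / r →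
      c * (r ^ 2 * ‖u‖ ^ 2) - M * (r * ‖u‖) ≤ f (θ0 + u) - f θ0)
    (hup : ∀ u, ‖u‖ ≤ (ρ + 1) / r →
      f (θ0 + u) - f θ0 ≤ C * (r ^ 2 * ‖u‖ ^ 2) + M * (r * ‖u‖))
    (hΘ : ∀ u, ‖u‖ ≤ (ρ + 1) / r → θ0 + u ∈ Θ)
    (hact : ∀ k, θ0 k ≠ 0 → Fintype.card ι * pen k ≤ r)
    (hinact : ∀ k, θ0 k = 0 → (C * (ρ + 1) ^ 2 + 2 * M * (ρ + 1)) * r < pen k)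
    (hmin : ∀ θ ∈ Θ, f θhat + ∑ k, pen k * |θhat k| ≤ f θ + ∑ k, pen k * |θ k|) :
    ∀ k, θ0 k = 0 → θhat k = 0 := by
  have hρr : ρ / r ≤ (ρ + 1) / r := by gcongr; linarith
  have hclose : ‖θhat - θ0‖ < ρ / r :=
    norm_sub_lt_of_penalized_minimizer hf hpen hr hρ hcρ
      (fun u hu => hlow u (hu.trans_le hρr)) hact
      (hmin θ0 (by simpa using hΘ 0 (by simpa using by positivity)))
  set θt : ι → ℝ := fun k => if θ0 k = 0 then 0 else θhat k with hθt
  set h : ι → ℝ := θhat - θt with hh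
  suffices hz : h = 0 by
    intro k hk
    have := congrFun hz k
    simpa [hh, hθt, hk] using this
  by_contra hne
  have hn : 0 < ‖h‖ := norm_pos_iff.2 hne
  have hθtclose : ‖θt - θ0‖ ≤ ρ / r := by
    refine le_trans ?_ hclose.le
    refine (pi_norm_le_iff_of_nonneg (norm_nonneg _)).2 fun k => ?_
    by_cases hk : θ0 k = 0
    · simp [hθt, hk]
    · simpa [hθt, hk] using norm_le_pi_norm (θhat - θ0) k
  set τ := 1 / r / ‖h‖ with hτ
  have hτ0 : 0 < τ := by positivity
  set y := θt - τ • h with hy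
  have hyclose : ‖y - θ0‖ ≤ (ρ + 1) / r := by
    have h1 : y - θ0 = (θt - θ0) - τ • h := by rw [hy]; abel
    have h2 : ‖τ • h‖ = 1 / r := by
      rw [norm_smul, Real.norm_of_nonneg hτ0.le, hτ, div_mul_cancel₀ _ hn.ne']
    rw [h1, add_div, ← h2]
    exact (norm_sub_le _ _).trans (by gcongr)
  have hconv : (1 + τ) * f θt ≤ τ * f θhat + f y := by
    have hcomb : θt = (τ / (1 + τ)) • θhat + (1 / (1 + τ)) • y := by
      funext k
      simp only [hy, hh, Pi.add_apply, Pi.smul_apply, Pi.sub_apply, smul_eq_mul]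
      field_simp
      ring
    have := hf.2 (Set.mem_univ θhat) (Set.mem_univ y)
      (show 0 ≤ τ / (1 + τ) by positivity) (show 0 ≤ 1 / (1 + τ) by positivity)
      (by field_simp; ring)
    rw [← hcomb, smul_eq_mul, smul_eq_mul] at this
    have h1 : (1 + τ) * (τ / (1 + τ) * f θhat + 1 / (1 + τ) * f y) = τ * f θhat + f y := by
      field_simp
    rw [← h1]
    exact mul_le_mul_of_nonneg_left this (by positivity)
  have hlowt : -(M * ρ) ≤ f θt - f θ0 := by
    have h1 := hlow (θt - θ0) (hθtclose.trans hρr)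
    rw [add_sub_cancel] at h1
    have h2 : r * ‖θt - θ0‖ ≤ ρ := by
      rw [mul_comm]
      exact (le_div_iff₀ hr).1 hθtclose
    have h3 : 0 ≤ c * (r ^ 2 * ‖θt - θ0‖ ^ 2) := by positivity
    nlinarith
  have hupy : f y - f θ0 ≤ C * (ρ + 1) ^ 2 + M * (ρ + 1) := by
    have h1 := hup (y - θ0) hyclose
    rw [add_sub_cancel] at h1
    have h2 : r * ‖y - θ0‖ ≤ ρ + 1 := by
      rw [mul_comm]
      exact (le_div_iff₀ hr).1 hyclose
    refine h1.trans ?_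
    rw [← mul_pow]
    gcongr
  have hpenalty : ∑ k, pen k * |θt k|
      + (C * (ρ + 1) ^ 2 + 2 * M * (ρ + 1)) * r * ‖h‖ < ∑ k, pen k * |θhat k| := by
    obtain ⟨k₀, hk₀⟩ : ∃ k, ‖h‖ ≤ |h k| := by
      by_contra! hlt
      exact lt_irrefl _ ((pi_norm_lt_iff hn).2 hlt)
    have hk₀z : θ0 k₀ = 0 := by
      by_contra hk
      have : h k₀ = 0 := by simp [hh, hθt, hk]
      rw [this, abs_zero] at hk₀
      linarith
    have hterm : ∀ k, pen k * |θt k| ≤ pen k * |θhat k| := fun k => by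
      by_cases hk : θ0 k = 0
      · simpa [hθt, hk] using mul_nonneg (hpen k) (abs_nonneg (θhat k))
      · simp [hθt, hk]
    have hsingle : pen k₀ * |θhat k₀| - pen k₀ * |θt k₀|
        ≤ ∑ k, (pen k * |θhat k| - pen k * |θt k|) :=
      Finset.single_le_sum (f := fun k => pen k * |θhat k| - pen k * |θt k|)
        (fun k _ => sub_nonneg.2 (hterm k)) (Finset.mem_univ k₀)
    have hval : pen k₀ * |θhat k₀| - pen k₀ * |θt k₀| = pen k₀ * |h k₀| := by
      simp [hh, hθt, hk₀z]
    rw [Finset.sum_sub_distrib, hval] at hsingle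
    have := mul_lt_mul (hinact k₀ hk₀z) hk₀ hn (hpen k₀)
    linarith
  have hθtΘ : θt ∈ Θ := by simpa using hΘ (θt - θ0) (hθtclose.trans hρr)
  have hgain := hmin θt hθtΘ
  have h1 : τ * ((C * (ρ + 1) ^ 2 + 2 * M * (ρ + 1)) * r * ‖h‖)
      = C * (ρ + 1) ^ 2 + 2 * M * (ρ + 1) := by
    rw [hτ]
    field_simp
  have h2 : τ * (f θhat - f θt) < -(C * (ρ + 1) ^ 2 + 2 * M * (ρ + 1)) := by
    rw [← h1, ← mul_neg]
    exact mul_lt_mul_of_pos_left (by linarith) hτ0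
  linarith

end Deterministic

section Probability

variable {n m : ℕ} {v : Fin n → Fin m → E} {w : E → E → ℝ} {g : E → ℝ} {θ0 : Idx m → ℝ}

lemma Pr_eq_gibbsMean (φ : (Fin n → Fin n → Bool) → Prop) :
    Pr n m v w g θ0 φ
      = gibbsMean (nets n) (Hvec n m v w g θ0) fun x => if φ x then 1 else 0 := by
  simp only [Pr, gibbsMean, Finset.sum_filter, ite_mul, one_mul, zero_mul]
  rfl

lemma Pr_le_one (φ : (Fin n → Fin n → Bool) → Prop) : Pr n m v w g θ0 φ ≤ 1 := by
  rw [Pr_eq_gibbsMean]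
  refine le_trans (gibbsMean_mono fun x _ => ?_) (gibbsMean_const (nets_nonempty n) 1).le
  split_ifs <;> norm_num

lemma one_le_add_Pr {φ ψ₁ ψ₂ ψ₃ : (Fin n → Fin n → Bool) → Prop}
    (h : ∀ x ∈ nets n, φ x ∨ ψ₁ x ∨ ψ₂ x ∨ ψ₃ x) :
    1 ≤ Pr n m v w g θ0 φ + Pr n m v w g θ0 ψ₁ + Pr n m v w g θ0 ψ₂ + Pr n m v w g θ0 ψ₃ := by
  simp only [Pr_eq_gibbsMean]
  rw [← gibbsMean_add, ← gibbsMean_add, ← gibbsMean_add]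
  refine (gibbsMean_const (nets_nonempty n) 1).ge.trans (gibbsMean_mono fun x hx => ?_)
  have hite : ∀ p : Prop, (0 : ℝ) ≤ if p then 1 else 0 := fun p => by
    split_ifs <;> norm_num
  have h0 := hite (φ x)
  have h1 := hite (ψ₁ x)
  have h2 := hite (ψ₂ x)
  have h3 := hite (ψ₃ x)
  rcases h x hx with hp | hp | hp | hp
  · rw [if_pos hp] at h0 ⊢
    linarith
  · rw [if_pos hp] at h1 ⊢
    linarith
  · rw [if_pos hp] at h2 ⊢
    linarith
  · rw [if_pos hp] at h3 ⊢
    linarith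

/-- Chebyshev's inequality for the `ℓ¹` norm of the score. -/
lemma Pr_score_le {M : ℝ} (hM : 0 < M) :
    Pr n m v w g θ0 (fun x => M < ∑ i, |score n m v w g θ0 x i|)
      ≤ Fintype.card (Idx m) * ∑ i, Ifish n m v w g θ0 i i / M ^ 2 := by
  rw [Pr_eq_gibbsMean]
  have h : ∀ x, (if M < ∑ i, |score n m v w g θ0 x i| then (1 : ℝ) else 0)
      ≤ Fintype.card (Idx m) / M ^ 2
        * ∑ i, score n m v w g θ0 x i * score n m v w g θ0 x i := fun x => by
    have hnn : 0 ≤ ∑ i, score n m v w g θ0 x i * score n m v w g θ0 x i :=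
      Finset.sum_nonneg fun i _ => mul_self_nonneg _
    split_ifs with hx
    · rw [div_mul_eq_mul_div, le_div_iff₀ (by positivity), one_mul]
      have hcs := sq_sum_le_card_mul_sum_sq (s := Finset.univ)
        (f := fun i => |score n m v w g θ0 x i|)
      simp only [sq_abs, Finset.card_univ] at hcs
      simp only [← sq]
      exact (pow_le_pow_left₀ hM.le hx.le 2).trans hcs
    · positivity
  refine (gibbsMean_mono fun x _ => h x).trans_eq ?_
  rw [gibbsMean_const_mul, gibbsMean_sum]
  simp only [gibbsMean_score_mul_score, ← Finset.sum_div]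
  ring

end Probability

lemma tendsto_sqrt_Ndyads :
    Filter.Tendsto (fun n : ℕ => Real.sqrt (Ndyads n)) Filter.atTop Filter.atTop := by
  refine Real.tendsto_sqrt_atTop.comp (tendsto_natCast_atTop_atTop.comp ?_)
  refine Filter.tendsto_atTop_mono' _ ?_ (Filter.tendsto_sub_atTop_nat 1)
  filter_upwards [Filter.eventually_ge_atTop 2] with n hn
  rw [Ndyads, Nat.le_div_iff_mul_le (by norm_num), mul_comm]
  exact Nat.mul_le_mul_right _ hn

/-- **Theorem 2, selection consistency.** Under conditions (C1) and
(C2), if `a_w/√N → 0` in probability and `b_w/√N → ∞` in probability, then the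
regularized maximum likelihood estimator sets all truly zero coefficients to zero with
probability tending to one: `P(θ̂_{N,k} = 0 for all k ∉ A) → 1`. -/
theorem rmle_selection_consistency {E : Type*} (m : ℕ) (hm : 1 ≤ m)
    (v : (n : ℕ) → Fin n → Fin m → E) (w : E → E → ℝ) (g : E → ℝ)
    (hw : ∀ u u' : E, w u u' = w u' u)
    (θ0 : Idx m → ℝ) (Θ : Set (Idx m → ℝ)) (Imat : Matrix (Idx m) (Idx m) ℝ)
    (hC1 : CondC1 m v w g θ0 Θ) (hC2 : CondC2 m v w g θ0 Imat)
    (hA : ((Finset.univ : Finset (Idx m)).filter fun k => θ0 k ≠ 0).Nonempty)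
    (hAc : ((Finset.univ : Finset (Idx m)).filter fun k => θ0 k = 0).Nonempty)
    (lam : ℕ → ℝ) (hlam : ∀ n, 0 ≤ lam n)
    (W : (n : ℕ) → (Fin n → Fin n → Bool) → Idx m → ℝ)
    (hW : ∀ n x k, 0 ≤ W n x k)
    -- `a_w/√N → 0` in probability, where `a_w = λ_N max_{k ∈ A} w_k`
    (haw : ∀ ε > (0 : ℝ),
      Filter.Tendsto
        (fun n : ℕ => Pr n m (v n) w g θ0
          (fun x => ε < lam n
            * (((Finset.univ : Finset (Idx m)).filter fun k => θ0 k ≠ 0).sup' hA (W n x))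
            / Real.sqrt (Ndyads n)))
        Filter.atTop (nhds 0))
    -- `b_w/√N → ∞` in probability, where `b_w = λ_N min_{k ∉ A} w_k`
    (hbw : ∀ M : ℝ,
      Filter.Tendsto
        (fun n : ℕ => Pr n m (v n) w g θ0
          (fun x => lam n
            * (((Finset.univ : Finset (Idx m)).filter fun k => θ0 k = 0).inf' hAc (W n x))
            / Real.sqrt (Ndyads n) ≤ M))
        Filter.atTop (nhds 0))
    (θhat : (n : ℕ) → (Fin n → Fin n → Bool) → (Idx m → ℝ))
    (hθhat : ∀ (n : ℕ) (x : Fin n → Fin n → Bool), x ∈ nets n →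
      θhat n x ∈ Θ ∧ ∀ θ ∈ Θ,
        -Llik n m (v n) w g (θhat n x) x + lam n * ∑ k, W n x k * |θhat n x k|
          ≤ -Llik n m (v n) w g θ x + lam n * ∑ k, W n x k * |θ k|) :
    Filter.Tendsto
      (fun n : ℕ => Pr n m (v n) w g θ0
        (fun x => ∀ k : Idx m, θ0 k = 0 → θhat n x k = 0))
      Filter.atTop (nhds 1) := by
  obtain ⟨⟨B₀, hB₀⟩, -, -, hθ0Θ⟩ := hC1
  obtain ⟨hI, hpd⟩ := hC2
  have hr := tendsto_sqrt_Ndyads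
  have hNpos : ∀ᶠ n : ℕ in Filter.atTop, 0 < (Ndyads n : ℝ) := by
    filter_upwards [hr.eventually_gt_atTop 0] with n hn using Real.sqrt_pos.1 hn
  have : Nonempty (Idx m) := ⟨Sum.inl 0⟩
  obtain ⟨c, hc, C, hC, hquad⟩ := eventually_quadForm_bounds hpd hNpos hI
  have htrace : Filter.Tendsto
      (fun n : ℕ => ∑ i, (((Ndyads n : ℝ))⁻¹ • Ifish n m (v n) w g θ0) i i)
      Filter.atTop (nhds (∑ i, Imat i i)) := by
    have hcont : Continuous fun A : Matrix (Idx m) (Idx m) ℝ => ∑ i, A i i := by fun_prop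
    exact (hcont.tendsto Imat).comp hI
  obtain ⟨δ, hδ, hball⟩ := Metric.isOpen_iff.1 isOpen_interior θ0 hθ0Θ
  set B := max 1 B₀
  have hB : ∀ (n : ℕ) (j1 j2 : Fin n) (k : Fin m),
      |w (v n j1 k) (v n j2 k)| ≤ B ∧ |g (v n j1 k)| ≤ B := fun n j1 j2 k =>
    ⟨(hB₀ n j1 j2 k).1.trans (le_max_right _ _), (hB₀ n j1 j2 k).2.trans (le_max_right _ _)⟩
  have hB1 : 1 ≤ B := le_max_left _ _
  set p : ℝ := (Fintype.card (Idx m) : ℝ) with hp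
  have hp0 : 0 < p := by
    rw [hp]
    exact_mod_cast Fintype.card_pos
  rw [tendsto_order]
  refine ⟨fun a ha => ?_, fun a ha => Filter.Eventually.of_forall fun n =>
    (Pr_le_one _).trans_lt ha⟩
  set η := (1 - a) / 3 with hη
  have hη0 : 0 < η := by
    rw [hη]
    linarith
  set T := ∑ i, Imat i i + 1
  obtain ⟨M, hM0, hM⟩ : ∃ M : ℝ, 0 < M ∧ p * T / M ^ 2 < η := by
    have h1 : Filter.Tendsto (fun M : ℝ => p * T / M ^ 2) Filter.atTop (nhds 0) :=
      tendsto_const_nhds.div_atTop (Filter.tendsto_pow_atTop two_ne_zero)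
    exact ((Filter.eventually_gt_atTop 0).and (h1.eventually_lt_const hη0)).exists
  set c₁ := c / 25 with hc₁
  have hc₁0 : 0 < c₁ := by positivity
  set ρ := (M + 2) / c₁ with hρ
  have hρ0 : 0 < ρ := by positivity
  have hcρ : M + 1 < c₁ * ρ := by
    rw [hρ, mul_div_cancel₀ _ hc₁0.ne']
    linarith
  have hradius : Filter.Tendsto (fun n : ℕ => (ρ + 1) / Real.sqrt (Ndyads n))
      Filter.atTop (nhds 0) := tendsto_const_nhds.div_atTop hr
  filter_upwards [hr.eventually_gt_atTop 0, hquad, hNpos,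
    htrace.eventually_lt_const (lt_add_one _), hradius.eventually_lt_const hδ,
    hradius.eventually_lt_const (show 0 < 1 / (4 * B * p) by positivity),
    (haw (1 / p) (by positivity)).eventually_lt_const hη0,
    (hbw (5 * C * (ρ + 1) ^ 2 + 2 * M * (ρ + 1))).eventually_lt_const hη0]
    with n hrn hquadn hN htr hδn hBn han hbn
  set r := Real.sqrt (Ndyads n) with hrdef
  have hrsq : r ^ 2 = Ndyads n := Real.sq_sqrt hN.le
  have hscore : Pr n m (v n) w g θ0 (fun x => M * r < ∑ i, |score n m (v n) w g θ0 x i|)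
      < η := by
    refine (Pr_score_le (by positivity)).trans_lt (lt_of_le_of_lt ?_ hM)
    rw [mul_pow, hrsq]
    simp only [Matrix.smul_apply, smul_eq_mul, ← Finset.mul_sum] at htr
    rw [← Finset.sum_div, mul_div_assoc]
    refine mul_le_mul_of_nonneg_left ?_ hp0.le
    rw [mul_comm, ← div_div, div_eq_inv_mul (∑ i, Ifish n m (v n) w g θ0 i i)]
    exact div_le_div_of_nonneg_right htr.le (sq_nonneg M)
  have hcover := one_le_add_Pr (v := v n) (w := w) (g := g) (θ0 := θ0)
    (φ := fun x => ∀ k : Idx m, θ0 k = 0 → θhat n x k = 0)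
    (ψ₁ := fun x => M * r < ∑ i, |score n m (v n) w g θ0 x i|)
    (ψ₂ := fun x => 1 / p < lam n
      * (((Finset.univ : Finset (Idx m)).filter fun k => θ0 k ≠ 0).sup' hA (W n x)) / r)
    (ψ₃ := fun x => lam n
      * (((Finset.univ : Finset (Idx m)).filter fun k => θ0 k = 0).inf' hAc (W n x)) / r
        ≤ 5 * C * (ρ + 1) ^ 2 + 2 * M * (ρ + 1)) ?_
  · linarith
  intro x hx
  by_contra! hbad
  obtain ⟨hnot, hsx, hax, hbx⟩ := hbad
  obtain ⟨k, hk, hkne⟩ := hnot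
  refine hkne ?_
  have hpen : ∀ k, 0 ≤ lam n * W n x k := fun k => mul_nonneg (hlam n) (hW n x k)
  have hbounds : ∀ u : Idx m → ℝ, ‖u‖ ≤ (ρ + 1) / r →
      c₁ * (r ^ 2 * ‖u‖ ^ 2) - M * (r * ‖u‖)
          ≤ -Llik n m (v n) w g (θ0 + u) x - -Llik n m (v n) w g θ0 x ∧
        -Llik n m (v n) w g (θ0 + u) x - -Llik n m (v n) w g θ0 x
          ≤ 5 * C * (r ^ 2 * ‖u‖ ^ 2) + M * (r * ‖u‖) := fun u hu => by
    have hsmall : ‖u‖ * (4 * B * Fintype.card (Idx m)) ≤ 1 :=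
      (le_div_iff₀ (by positivity)).1 (hu.trans hBn.le)
    obtain ⟨h1, h2⟩ := gibbsCgf_Hvec_bounds hw hB1 (hB n) θ0 u hsmall
    obtain ⟨h3, h4⟩ := hquadn u
    rw [← gibbsVar_Hvec, ← hrsq] at h3 h4
    have h5 := abs_le.1 ((abs_sum_mul_le_norm u (score n m (v n) w g θ0 x)).trans
      (mul_le_mul_of_nonneg_left hsx (norm_nonneg u)))
    rw [neg_Llik_add_sub]
    constructor
    · rw [hc₁, div_mul_eq_mul_div]
      linarith [h5.2]
    · linarith [h5.1]
  refine penalized_minimizer_eq_zero (convexOn_neg_Llik (v := v n) (w := w) (g := g) x)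
    (Θ := Θ) (pen := fun k => lam n * W n x k) hpen hrn hρ0 hc₁0.le
    (show 0 ≤ 5 * C by positivity) hM0.le hcρ (fun u hu => (hbounds u hu).1)
    (fun u hu => (hbounds u hu).2) ?_ ?_ ?_ ?_ k hk
  · intro u hu
    refine interior_subset (hball ?_)
    simpa using hu.trans_lt hδn
  · intro k hk
    have hle := Finset.le_sup' (W n x)
      (Finset.mem_filter.2 ⟨Finset.mem_univ k, hk⟩ :
        k ∈ (Finset.univ : Finset (Idx m)).filter fun k => θ0 k ≠ 0)
    rw [div_le_div_iff₀ hrn hp0, one_mul] at hax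
    have := mul_le_mul_of_nonneg_left (mul_le_mul_of_nonneg_left hle (hlam n)) hp0.le
    linarith
  · intro k hk
    have hle := Finset.inf'_le (W n x)
      (Finset.mem_filter.2 ⟨Finset.mem_univ k, hk⟩ :
        k ∈ (Finset.univ : Finset (Idx m)).filter fun k => θ0 k = 0)
    exact ((lt_div_iff₀ hrn).1 hbx).trans_le (mul_le_mul_of_nonneg_left hle (hlam n))
  · intro θ hθ
    simpa only [Finset.mul_sum, mul_assoc] using (hθhat n x hx).2 θ hθ
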